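/- arXiv:1709.06769 — 2 statements merged into one kernel-verified Lean document; each statement's English description precedes it below -/
import Mathlib

section
/- Let Γ = (I,E,s,t) be a quiver with finite nonempty vertex set I and finite edge set E, p a prime, α ≥ 1, and R = ℤ/p^αℤ. The group G = (R^×)^I acts on the set of 1-dimensional representations x : E → R by (g·x)(e) = g(t(e)) · x(e) · g(s(e))⁻¹; call x indecomposable if the graph (I, {e : x(e) ≠ 0}) is connected. Then the number A_{Γ,α} of G-orbits of indecomposable representations equals Σ (p−1)^{b(E_α)} p^{Σ_{k=1}^{α−1} b(E_k)}, where the sum is over all chains of edge subsets E₁ ⊆ E₂ ⊆ ⋯ ⊆ E_α ⊆ E such that the graph (I,E_α) is connected, and where for E' ⊆ E, b(E') = c(E') − |I| + |E'| with c(E') the number of connected components of (I,E'). -/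
open scoped Classical

theorem Nat.modEq_pow_iff_digits (p a b j : ℕ) :
    a ≡ b [MOD p ^ j] ↔ ∀ i < j, a / p ^ i % p = b / p ^ i % p := by
  induction j with
  | zero => simp [Nat.modEq_one]
  | succ j ih =>
    rw [Nat.forall_lt_succ_right, ← ih]
    constructor
    · intro h
      refine ⟨h.of_mul_right p, ?_⟩
      have := congrArg (· / p ^ j) h
      simpa [pow_succ, Nat.mod_mul_right_div_self] using this
    · rintro ⟨h1, h2⟩
      unfold Nat.ModEq at *
      rw [Nat.mod_pow_succ, Nat.mod_pow_succ, h1, h2]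

theorem Prime.pow_dvd_of_pow_add_dvd_mul {p : ℤ} (hp : Prime p) {x y : ℤ} {k m : ℕ}
    (hx : ¬ p ^ (k + 1) ∣ x) (h : p ^ (m + k) ∣ y * x) : p ^ m ∣ y := by
  induction k generalizing x with
  | zero => exact hp.pow_dvd_of_dvd_mul_right m (by simpa using hx) h
  | succ k ih =>
    by_cases hpx : p ∣ x
    · obtain ⟨x', rfl⟩ := hpx
      refine ih (x := x') (fun h' => hx ?_) ?_
      · rw [pow_succ']; exact mul_dvd_mul_left p h'
      · rw [← add_assoc, pow_succ', mul_left_comm] at h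
        exact (mul_dvd_mul_iff_left hp.ne_zero).1 h
    · exact (pow_dvd_pow p (by omega)).trans (hp.pow_dvd_of_dvd_mul_right _ hpx h)

theorem Prime.pow_dvd_mul_iff_forall {p : ℤ} (hp : Prime p) (x y : ℤ) (n : ℕ) :
    p ^ (n + 1) ∣ y * x ↔ ∀ k ≤ n, ¬ p ^ (k + 1) ∣ x → p ^ (n + 1 - k) ∣ y := by
  constructor
  · intro h k hk hx
    refine hp.pow_dvd_of_pow_add_dvd_mul hx ?_
    rwa [Nat.sub_add_cancel (by omega)]
  · intro h
    by_cases hx : p ^ (n + 1) ∣ x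
    · exact hx.mul_left y
    have hex : ∃ k, ¬ p ^ (k + 1) ∣ x := ⟨n, hx⟩
    have hle : Nat.find hex ≤ n := Nat.find_min' hex hx
    have hk : p ^ Nat.find hex ∣ x := by
      rcases hk : Nat.find hex with _ | k
      · simp
      · exact not_not.1 (Nat.find_min hex (m := k) (by omega))
    have := mul_dvd_mul (h _ hle (Nat.find_spec hex)) hk
    rwa [← pow_add, Nat.sub_add_cancel (by omega)] at this

/-- The `i`-th base `p` digit of a residue class modulo `p ^ (n + 1)`. -/
def pDigit (p n : ℕ) [NeZero p] (a : ZMod (p ^ (n + 1))) (i : Fin (n + 1)) : Fin p :=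
  ⟨a.val / p ^ (i : ℕ) % p, Nat.mod_lt _ (NeZero.pos p)⟩

theorem pDigit_eq_on_lt_iff (p n : ℕ) [NeZero p] (a b : ZMod (p ^ (n + 1))) (j : ℕ)
    (hj : j ≤ n + 1) :
    (∀ i : Fin (n + 1), (i : ℕ) < j → pDigit p n a i = pDigit p n b i) ↔
      (p : ℤ) ^ j ∣ (a.val : ℤ) - b.val := by
  have h := (Nat.modEq_pow_iff_digits p b.val a.val j)
  rw [Nat.modEq_iff_dvd] at h
  push_cast at h
  rw [h]
  constructor
  · intro h i hi
    exact (Fin.ext_iff.1 (h ⟨i, by omega⟩ hi)).symm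
  · intro h i hi
    exact Fin.ext (h i hi).symm

theorem pDigit_bijective (p n : ℕ) [NeZero p] : Function.Bijective (pDigit p n) := by
  rw [Fintype.bijective_iff_injective_and_card]
  refine ⟨fun a b hab => ?_, by simp [ZMod.card]⟩
  have h := (pDigit_eq_on_lt_iff p n a b (n + 1) le_rfl).1 fun i _ => congrFun hab i
  have h2 := (ZMod.intCast_zmod_eq_zero_iff_dvd ((a.val : ℤ) - b.val) (p ^ (n + 1))).2
    (by simpa using h)
  simpa [sub_eq_zero] using h2

theorem pDigit_zero (p n : ℕ) [NeZero p] (i : Fin (n + 1)) : pDigit p n 0 i = 0 := by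
  apply Fin.ext; simp [pDigit]

theorem exists_pDigit_ne_zero_iff (p n : ℕ) [NeZero p] (a : ZMod (p ^ (n + 1)))
    (k : Fin (n + 1)) :
    (∃ i ≤ k, pDigit p n a i ≠ 0) ↔ ¬ (p : ℤ) ^ ((k : ℕ) + 1) ∣ (a.val : ℤ) := by
  have h := pDigit_eq_on_lt_iff p n a 0 (k + 1) (by omega)
  rw [ZMod.val_zero, Nat.cast_zero, sub_zero] at h
  rw [← h]
  push Not
  simp only [pDigit_zero, Nat.lt_succ_iff, ← Fin.le_def]

theorem exists_pDigit_ne_zero_iff_ne_zero (p n : ℕ) [NeZero p] (a : ZMod (p ^ (n + 1))) :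
    (∃ i ≤ Fin.last n, pDigit p n a i ≠ 0) ↔ a ≠ 0 := by
  have : a = 0 ↔ pDigit p n a = pDigit p n 0 := (pDigit_bijective p n).1.eq_iff.symm
  rw [ne_eq, this, funext_iff]
  push Not
  simp [pDigit_zero, Fin.le_last]

theorem isUnit_iff_pDigit_ne_zero {p : ℕ} [NeZero p] (hp : p.Prime) (n : ℕ)
    (a : ZMod (p ^ (n + 1))) : IsUnit a ↔ pDigit p n a 0 ≠ 0 := by
  have h := ZMod.isUnit_iff_coprime a.val (p ^ (n + 1))
  rw [ZMod.natCast_zmod_val] at h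
  rw [h, Nat.coprime_pow_right_iff (by omega), Nat.coprime_comm, hp.coprime_iff_not_dvd, ne_eq,
    Fin.ext_iff]
  simp [pDigit, Nat.dvd_iff_mod_eq_zero]

theorem sub_mul_eq_zero_iff_pDigit {p : ℕ} [NeZero p] (hp : p.Prime) (n : ℕ)
    (a b x : ZMod (p ^ (n + 1))) :
    (a - b) * x = 0 ↔ ∀ k : Fin (n + 1), (∃ i ≤ k, pDigit p n x i ≠ 0) →
      pDigit p n a k.rev = pDigit p n b k.rev := by
  have h := ZMod.intCast_zmod_eq_zero_iff_dvd (((a.val : ℤ) - b.val) * x.val) (p ^ (n + 1))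
  push_cast at h
  simp only [ZMod.natCast_zmod_val] at h
  rw [h, (Nat.prime_iff_prime_int.1 hp).pow_dvd_mul_iff_forall]
  constructor
  · intro h k hk
    rw [exists_pDigit_ne_zero_iff] at hk
    have := h k (by omega) hk
    rw [← pDigit_eq_on_lt_iff p n a b _ (by omega)] at this
    exact this _ (by rw [Fin.val_rev]; omega)
  · intro h k hk hx
    rw [← pDigit_eq_on_lt_iff p n a b _ (by omega)]
    intro i hi
    obtain ⟨j, hj, hj'⟩ := (exists_pDigit_ne_zero_iff p n x ⟨k, by omega⟩).2 hx
    have := h i.rev ⟨j, hj.trans (by rw [Fin.le_def, Fin.val_rev]; simp only; omega), hj'⟩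
    rwa [Fin.rev_rev] at this

/-- Counting digit sequences with a prescribed set of nonzero truncations. -/
theorem card_digits_of_monotone (p n : ℕ) [NeZero p] (P : Fin (n + 1) → Prop)
    (hP : Monotone P) :
    Nat.card {d : Fin (n + 1) → Fin p // ∀ k, (∃ i ≤ k, d i ≠ 0) ↔ P k} =
      (if P (Fin.last n) then p - 1 else 1) * ∏ k : Fin n, if P k.castSucc then p else 1 := by
  induction n with
  | zero =>
    have e : {d : Fin 1 → Fin p // ∀ k, (∃ i ≤ k, d i ≠ 0) ↔ P k} ≃
        {a : Fin p // a ≠ 0 ↔ P 0} :=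
      (Equiv.funUnique (Fin 1) (Fin p)).subtypeEquiv fun d => by
        constructor
        · intro h
          simpa using h 0
        · intro h k
          simpa [Subsingleton.elim k 0] using h
    rw [Nat.card_congr e]
    by_cases h0 : P 0 <;> simp [h0, Fintype.card_subtype_compl]
  | succ n ih =>
    by_cases h0 : P 0
    · have hall : ∀ k, P k := fun k => hP (Fin.zero_le k) h0
      have e : {d : Fin (n + 2) → Fin p // ∀ k, (∃ i ≤ k, d i ≠ 0) ↔ P k} ≃
          {a : Fin p // a ≠ 0} × (Fin (n + 1) → Fin p) :=
        { toFun := fun d => ⟨⟨d.1 0, by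
              obtain ⟨i, hi, h⟩ := (d.2 0).2 h0
              rwa [Fin.le_zero_iff.1 hi] at h⟩, fun i => d.1 i.succ⟩
          invFun := fun q => ⟨Fin.cons q.1.1 q.2, fun k =>
            ⟨fun _ => hall k, fun _ => ⟨0, Fin.zero_le k, by simpa using q.1.2⟩⟩⟩
          left_inv := fun d => Subtype.ext (Fin.cons_self_tail d.1)
          right_inv := fun q => by ext <;> simp }
      rw [Nat.card_congr e]
      simp [hall, Fintype.card_subtype_compl]
    · have e : {d : Fin (n + 2) → Fin p // ∀ k, (∃ i ≤ k, d i ≠ 0) ↔ P k} ≃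
          {d : Fin (n + 1) → Fin p // ∀ k, (∃ i ≤ k, d i ≠ 0) ↔ P k.succ} :=
        { toFun := fun d => ⟨fun i => d.1 i.succ, fun k => by
            have hd : d.1 0 = 0 := by
              by_contra h
              exact h0 ((d.2 0).1 ⟨0, le_rfl, h⟩)
            rw [← d.2 k.succ, Fin.exists_fin_succ (n := n + 1)]
            simp [hd]⟩
          invFun := fun d => ⟨Fin.cons 0 d.1, fun k => by
            cases k using Fin.cases with
            | zero => simp [h0]
            | succ k =>
              rw [← d.2 k, Fin.exists_fin_succ (n := n + 1)]
              simp⟩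
          left_inv := fun d => by
            have hd : d.1 0 = 0 := by
              by_contra h
              exact h0 ((d.2 0).1 ⟨0, le_rfl, h⟩)
            apply Subtype.ext
            conv_rhs => rw [← Fin.cons_self_tail d.1, hd]
            rfl
          right_inv := fun d => by ext; simp }
      rw [Nat.card_congr e, ih (fun k => P k.succ) fun a b h => hP (Fin.succ_le_succ_iff.2 h),
        Fin.prod_univ_succ (n := n)]
      simp [h0]

/-- Functions constant along the edges in `S` are functions on the connected components. -/
def edgeInvariantEquiv {I E D : Type*} (s t : E → I) (S : Finset E) :
    {h : I → D // ∀ e ∈ S, h (t e) = h (s e)} ≃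
      (Quot (fun i j : I => ∃ e ∈ S, s e = i ∧ t e = j) → D) where
  toFun h := Quot.lift h.1 (by rintro _ _ ⟨e, he, rfl, rfl⟩; exact (h.2 e he).symm)
  invFun f := ⟨fun i => f (Quot.mk _ i), fun e he =>
    congrArg f (Quot.sound ⟨e, he, rfl, rfl⟩).symm⟩
  left_inv _ := rfl
  right_inv f := by
    funext q
    induction q using Quot.ind
    rfl

theorem card_edgeInvariant {I E D : Type*} [Finite I] (s t : E → I) (S : Finset E) :
    Nat.card {h : I → D // ∀ e ∈ S, h (t e) = h (s e)} =
      Nat.card D ^ Nat.card (Quot (fun i j : I => ∃ e ∈ S, s e = i ∧ t e = j)) := by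
  rw [Nat.card_congr (edgeInvariantEquiv s t S), Nat.card_fun]

/-- The digits of a unit, in reverse order; only the digit in degree zero is constrained. -/
noncomputable def unitsDigitsEquiv {p : ℕ} [NeZero p] (hp : p.Prime) (n : ℕ) :
    (ZMod (p ^ (n + 1)))ˣ ≃
      (∀ k : Fin (n + 1), {d : Fin p // k = Fin.last n → d ≠ 0}) :=
  Equiv.ofBijective
    (fun u k => ⟨pDigit p n u k.rev, by
      rintro rfl
      rw [Fin.rev_last]
      exact (isUnit_iff_pDigit_ne_zero hp n _).1 u.isUnit⟩) <| by
    constructor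
    · intro u v h
      apply Units.ext
      apply (pDigit_bijective p n).1
      funext i
      have := congrArg Subtype.val (congrFun h i.rev)
      simpa using this
    · intro d
      obtain ⟨a, ha⟩ := (pDigit_bijective p n).2 fun i => (d i.rev).1
      have hu : IsUnit a := by
        rw [isUnit_iff_pDigit_ne_zero hp, ha]
        exact (d _).2 (Fin.rev_zero n)
      obtain ⟨u, rfl⟩ := hu
      refine ⟨u, funext fun k => Subtype.ext ?_⟩
      simp only [ha]
      rw [Fin.rev_rev]

theorem card_units_edge_congruent {I E : Type*} [Finite I] (s t : E → I) {p : ℕ} [NeZero p]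
    (hp : p.Prime) (n : ℕ) (c : Fin (n + 1) → Finset E) :
    Nat.card {g : I → (ZMod (p ^ (n + 1)))ˣ // ∀ k, ∀ e ∈ c k,
        pDigit p n (g (t e)) k.rev = pDigit p n (g (s e)) k.rev} =
      (p - 1) ^ Nat.card (Quot (fun i j : I => ∃ e ∈ c (Fin.last n), s e = i ∧ t e = j)) *
        ∏ k : Fin n,
          p ^ Nat.card (Quot (fun i j : I => ∃ e ∈ c k.castSucc, s e = i ∧ t e = j)) := by
  have e1 : {g : I → (ZMod (p ^ (n + 1)))ˣ // ∀ k, ∀ e ∈ c k,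
        pDigit p n (g (t e)) k.rev = pDigit p n (g (s e)) k.rev} ≃
      {h : ∀ k : Fin (n + 1), I → {d : Fin p // k = Fin.last n → d ≠ 0} //
        ∀ k, ∀ e ∈ c k, h k (t e) = h k (s e)} :=
    ((Equiv.piCongrRight fun _ : I => unitsDigitsEquiv hp n).trans
      (Equiv.piComm _)).subtypeEquiv fun g => by
        refine forall₃_congr fun k e _ => ?_
        rw [Subtype.ext_iff]
        rfl
  rw [Nat.card_congr (e1.trans (Equiv.subtypePiEquivPi
    (p := fun k (h : I → {d : Fin p // k = Fin.last n → d ≠ 0}) =>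
      ∀ e ∈ c k, h (t e) = h (s e)))), Nat.card_pi]
  simp_rw [card_edgeInvariant]
  rw [Fin.prod_univ_castSucc, mul_comm]
  have h1 : Nat.card {d : Fin p // Fin.last n = Fin.last n → d ≠ 0} = p - 1 := by
    simp [Fintype.card_subtype_compl]
  have h2 (k : Fin n) : Nat.card {d : Fin p // k.castSucc = Fin.last n → d ≠ 0} = p := by
    simp [Fin.castSucc_ne_last]
  rw [h1]
  simp_rw [h2]

/-- The edges whose value is nonzero modulo `p ^ (k + 1)`. -/
noncomputable def supportChain {E : Type*} [Fintype E] (p n : ℕ) [NeZero p]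
    (x : E → ZMod (p ^ (n + 1))) (k : Fin (n + 1)) : Finset E :=
  Finset.univ.filter fun e => ∃ i ≤ k, pDigit p n (x e) i ≠ 0

theorem supportChain_monotone {E : Type*} [Fintype E] (p n : ℕ) [NeZero p]
    (x : E → ZMod (p ^ (n + 1))) : Monotone (supportChain p n x) := by
  intro k l hkl e he
  simp only [supportChain, Finset.mem_filter, Finset.mem_univ, true_and] at he ⊢
  obtain ⟨i, hi, h⟩ := he
  exact ⟨i, hi.trans hkl, h⟩

theorem supportChain_last {E : Type*} [Fintype E] (p n : ℕ) [NeZero p]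
    (x : E → ZMod (p ^ (n + 1))) :
    supportChain p n x (Fin.last n) = Finset.univ.filter fun e => x e ≠ 0 := by
  unfold supportChain
  simp_rw [exists_pDigit_ne_zero_iff_ne_zero]

theorem prod_ite_mem_const {E : Type*} [Fintype E] (S : Finset E) [DecidablePred (· ∈ S)]
    (a : ℕ) : ∏ e, (if e ∈ S then a else 1) = a ^ S.card := by
  rw [← Finset.prod_filter, Finset.prod_const]
  congr 2
  ext e
  simp

theorem card_supportChain_eq {E : Type*} [Fintype E] (p n : ℕ) [NeZero p]
    (c : Fin (n + 1) → Finset E) (hc : Monotone c) :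
    Nat.card {x : E → ZMod (p ^ (n + 1)) // supportChain p n x = c} =
      (p - 1) ^ (c (Fin.last n)).card * ∏ k : Fin n, p ^ (c k.castSucc).card := by
  have e1 : {x : E → ZMod (p ^ (n + 1)) // supportChain p n x = c} ≃
      {d : E → Fin (n + 1) → Fin p // ∀ e k, (∃ i ≤ k, d e i ≠ 0) ↔ e ∈ c k} :=
    (Equiv.piCongrRight fun _ : E => Equiv.ofBijective _ (pDigit_bijective p n)).subtypeEquiv
      fun x => by
        simp only [funext_iff, Finset.ext_iff, supportChain, Finset.mem_filter, Finset.mem_univ,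
          true_and, Equiv.piCongrRight_apply, Pi.map_apply, Equiv.ofBijective_apply]
        exact forall_comm
  rw [Nat.card_congr (e1.trans (Equiv.subtypePiEquivPi
    (p := fun e (d : Fin (n + 1) → Fin p) => ∀ k, (∃ i ≤ k, d i ≠ 0) ↔ e ∈ c k))), Nat.card_pi]
  rw [Finset.prod_congr rfl fun e _ => card_digits_of_monotone p n (fun k => e ∈ c k)
    fun k l hkl h => hc hkl h]
  rw [Finset.prod_mul_distrib, Finset.prod_comm]
  congr 1
  · exact @prod_ite_mem_const _ _ _ (fun _ => Classical.propDecidable _) _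
  · exact Finset.prod_congr rfl fun k _ =>
      @prod_ite_mem_const _ _ _ (fun _ => Classical.propDecidable _) _

theorem sum_card_stabilizer (G X : Type*) [Group G] [MulAction G X] [Finite G] [Fintype X] :
    ∑ x : X, Nat.card {g : G // g • x = x} =
      Nat.card (Quotient (MulAction.orbitRel G X)) * Nat.card G := by
  rw [← Nat.card_prod, ← Nat.card_congr (MulAction.sigmaFixedByEquivOrbitsProdGroup G X),
    ← Nat.card_sigma]
  exact Nat.card_congr
    { toFun := fun q => ⟨q.2.1, q.1, q.2.2⟩
      invFun := fun q => ⟨q.2.1, q.1, q.2.2⟩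
      left_inv := fun _ => rfl
      right_inv := fun _ => rfl }

/-- The gauge action on the `1`-dimensional representations whose support satisfies `conn`. -/
@[reducible]
def gaugeAction {I E : Type*} [Fintype E] (N : ℕ) (s t : E → I)
    (conn : Finset E → Prop) :
    MulAction (I → (ZMod N)ˣ) {x : E → ZMod N // conn (Finset.univ.filter fun e => x e ≠ 0)} where
  smul g x := ⟨fun e => (g (t e) : ZMod N) * x.1 e * ((g (s e))⁻¹ : (ZMod N)ˣ), by
    simpa using x.2⟩
  one_smul x := Subtype.ext (funext fun e => by
    change ((1 : (ZMod N)ˣ) : ZMod N) * x.1 e * ((1 : (ZMod N)ˣ)⁻¹ : (ZMod N)ˣ) = x.1 e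
    simp)
  mul_smul g h x := Subtype.ext (funext fun e => by
    change ((g (t e) * h (t e) : (ZMod N)ˣ) : ZMod N) * x.1 e *
        ((g (s e) * h (s e))⁻¹ : (ZMod N)ˣ) =
      (g (t e) : ZMod N) * ((h (t e) : ZMod N) * x.1 e * ((h (s e))⁻¹ : (ZMod N)ˣ)) *
        ((g (s e))⁻¹ : (ZMod N)ˣ)
    simp only [mul_inv, Units.val_mul]
    ring)

theorem card_stabilizer_eq {I E : Type*} [Finite I] [Fintype E] (s t : E → I) {p : ℕ} [NeZero p]
    (hp : p.Prime) (n : ℕ) (x : E → ZMod (p ^ (n + 1))) :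
    Nat.card {g : I → (ZMod (p ^ (n + 1)))ˣ // ∀ e,
        (g (t e) : ZMod (p ^ (n + 1))) * x e * ((g (s e))⁻¹ : (ZMod (p ^ (n + 1)))ˣ) = x e} =
      (p - 1) ^ Nat.card (Quot (fun i j : I =>
          ∃ e ∈ supportChain p n x (Fin.last n), s e = i ∧ t e = j)) *
        ∏ k : Fin n, p ^ Nat.card (Quot (fun i j : I =>
          ∃ e ∈ supportChain p n x k.castSucc, s e = i ∧ t e = j)) := by
  rw [← card_units_edge_congruent s t hp n]
  refine Nat.card_congr (Equiv.subtypeEquivRight fun g => ?_)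
  rw [forall_comm]
  refine forall_congr' fun e => ?_
  rw [Units.mul_inv_eq_iff_eq_mul, mul_comm (x e), ← sub_eq_zero, ← sub_mul,
    sub_mul_eq_zero_iff_pDigit hp]
  simp [supportChain]

theorem card_orbits_mul_card_units {I E : Type*} [Fintype I] [Fintype E] (s t : E → I)
    {p : ℕ} (hp : p.Prime) (n : ℕ) (conn : Finset E → Prop) :
    Nat.card (Quot (fun x y :
        {x : E → ZMod (p ^ (n + 1)) // conn (Finset.univ.filter (fun e => x e ≠ 0))} =>
      ∃ g : I → (ZMod (p ^ (n + 1)))ˣ, ∀ e : E, y.1 e =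
        (g (t e) : ZMod (p ^ (n + 1))) * x.1 e * ((g (s e))⁻¹ : (ZMod (p ^ (n + 1)))ˣ))) *
      ((p - 1) * p ^ n) ^ Fintype.card I =
    ∑ c ∈ Finset.univ.filter (fun c : Fin (n + 1) → Finset E =>
        Monotone c ∧ conn (c (Fin.last n))),
      ((p - 1) ^ (c (Fin.last n)).card * ∏ k : Fin n, p ^ (c k.castSucc).card) *
      ((p - 1) ^ Nat.card (Quot (fun i j : I => ∃ e ∈ c (Fin.last n), s e = i ∧ t e = j)) *
        ∏ k : Fin n,
          p ^ Nat.card (Quot (fun i j : I => ∃ e ∈ c k.castSucc, s e = i ∧ t e = j))) := by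
  have : NeZero p := ⟨hp.ne_zero⟩
  let := gaugeAction (p ^ (n + 1)) s t conn
  have hG : Nat.card (I → (ZMod (p ^ (n + 1)))ˣ) = ((p - 1) * p ^ n) ^ Fintype.card I := by
    rw [Nat.card_fun, Nat.card_eq_fintype_card (α := I), Nat.card_eq_fintype_card,
      ZMod.card_units_eq_totient, Nat.totient_prime_pow_succ hp, mul_comm]
  have hrel : (fun x y :
        {x : E → ZMod (p ^ (n + 1)) // conn (Finset.univ.filter (fun e => x e ≠ 0))} =>
      ∃ g : I → (ZMod (p ^ (n + 1)))ˣ, ∀ e : E, y.1 e =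
        (g (t e) : ZMod (p ^ (n + 1))) * x.1 e * ((g (s e))⁻¹ : (ZMod (p ^ (n + 1)))ˣ)) =
      (MulAction.orbitRel (I → (ZMod (p ^ (n + 1)))ˣ)
        {x : E → ZMod (p ^ (n + 1)) // conn (Finset.univ.filter (fun e => x e ≠ 0))}).r := by
    funext x y
    apply propext
    rw [Setoid.comm', MulAction.orbitRel_apply, MulAction.mem_orbit_iff]
    refine exists_congr fun g => ?_
    rw [Subtype.ext_iff, funext_iff]
    exact forall_congr' fun e => eq_comm
  rw [hrel, ← hG]
  refine (sum_card_stabilizer (I → (ZMod (p ^ (n + 1)))ˣ)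
    {x : E → ZMod (p ^ (n + 1)) // conn (Finset.univ.filter (fun e => x e ≠ 0))}).symm.trans ?_
  have hstab (x : {x : E → ZMod (p ^ (n + 1)) //
        conn (Finset.univ.filter (fun e => x e ≠ 0))}) :
      Nat.card {g : I → (ZMod (p ^ (n + 1)))ˣ // g • x = x} =
      (p - 1) ^ Nat.card (Quot (fun i j : I =>
          ∃ e ∈ supportChain p n x.1 (Fin.last n), s e = i ∧ t e = j)) *
        ∏ k : Fin n, p ^ Nat.card (Quot (fun i j : I =>
          ∃ e ∈ supportChain p n x.1 k.castSucc, s e = i ∧ t e = j)) := by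
    rw [← card_stabilizer_eq s t hp n x.1]
    refine Nat.card_congr (Equiv.subtypeEquivRight fun g => ?_)
    rw [Subtype.ext_iff, funext_iff]
    rfl
  rw [Finset.sum_congr rfl fun x _ => hstab x]
  rw [← Finset.sum_fiberwise_of_maps_to (s := Finset.univ)
    (t := Finset.univ.filter fun c : Fin (n + 1) → Finset E =>
      Monotone c ∧ conn (c (Fin.last n))) (g := fun x => supportChain p n x.1)
    (fun x _ => by
      rw [Finset.mem_filter, supportChain_last]
      exact ⟨Finset.mem_univ _, supportChain_monotone p n x.1, x.2⟩)]
  refine Finset.sum_congr rfl fun c hc => ?_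
  obtain ⟨hmono, hcon⟩ := (Finset.mem_filter.1 hc).2
  rw [← card_supportChain_eq p n c hmono, Finset.sum_congr rfl (g := fun _ =>
    (p - 1) ^ Nat.card (Quot (fun i j : I => ∃ e ∈ c (Fin.last n), s e = i ∧ t e = j)) *
        ∏ k : Fin n,
          p ^ Nat.card (Quot (fun i j : I => ∃ e ∈ c k.castSucc, s e = i ∧ t e = j)))
    fun x hx => by rw [(Finset.mem_filter.1 hx).2], Finset.sum_const, smul_eq_mul]
  congr 1
  rw [← Fintype.card_subtype, ← Nat.card_eq_fintype_card]
  exact Nat.card_congr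
    { toFun := fun x => ⟨x.1.1, x.2⟩
      invFun := fun x => ⟨⟨x.1, by rw [← supportChain_last, x.2]; exact hcon⟩, x.2⟩
      left_inv := fun _ => rfl
      right_inv := fun _ => rfl }

theorem zpow_sum_eq_prod {ι K : Type*} [Field K] {a : K} (ha : a ≠ 0) (S : Finset ι)
    (f : ι → ℤ) : a ^ (∑ i ∈ S, f i) = ∏ i ∈ S, a ^ f i := by
  induction S using Finset.induction_on with
  | empty => simp
  | insert i S hi ih => rw [Finset.sum_insert hi, Finset.prod_insert hi, zpow_add₀ ha, ih]

theorem stmt_15 {I E : Type*} [Fintype I] [Fintype E] [Nonempty I] (s t : E → I)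
    (p : ℕ) (hp : p.Prime) (α : ℕ) (hα : 1 ≤ α)
    (conn : Finset E → Prop)
    (hconn : ∀ E' : Finset E, conn E' ↔
      Nat.card (Quot (fun i j : I => ∃ e ∈ E', s e = i ∧ t e = j)) = 1)
    (b : Finset E → ℤ)
    (hb : ∀ E' : Finset E, b E' =
      (Nat.card (Quot (fun i j : I => ∃ e ∈ E', s e = i ∧ t e = j)) : ℤ)
        - Fintype.card I + E'.card) :
    (Nat.card (Quot (fun x y :
        {x : E → ZMod (p ^ α) // conn (Finset.univ.filter (fun e => x e ≠ 0))} =>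
      ∃ g : I → (ZMod (p ^ α))ˣ, ∀ e : E,
        y.1 e = (g (t e) : ZMod (p ^ α)) * x.1 e * ((g (s e))⁻¹ : (ZMod (p ^ α))ˣ))) : ℚ)
      = ∑ c ∈ Finset.univ.filter (fun c : Fin α → Finset E =>
            Monotone c ∧ conn (c ⟨α - 1, by omega⟩)),
          ((p : ℚ) - 1) ^ (b (c ⟨α - 1, by omega⟩)) *
            (p : ℚ) ^ (∑ i ∈ Finset.univ.filter (fun i : Fin α => (i : ℕ) + 1 < α), b (c i)) := by
  obtain ⟨n, rfl⟩ : ∃ n, α = n + 1 := ⟨α - 1, by omega⟩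
  have hp0 : (p : ℚ) ≠ 0 := by exact_mod_cast hp.ne_zero
  have hp1 : (p : ℚ) - 1 ≠ 0 := sub_ne_zero.2 (by exact_mod_cast hp.one_lt.ne')
  have hG : (((p : ℚ) - 1) * (p : ℚ) ^ n) ^ Fintype.card I ≠ 0 := by positivity
  have key := congrArg (Nat.cast : ℕ → ℚ) (card_orbits_mul_card_units s t hp n conn)
  push_cast [Nat.cast_sub hp.one_le] at key
  rw [← mul_left_inj' hG, key, Finset.sum_mul]
  refine Finset.sum_congr rfl fun c _ => ?_
  have hsum : ∑ i ∈ Finset.univ.filter (fun i : Fin (n + 1) => (i : ℕ) + 1 < n + 1), b (c i) =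
      ∑ k : Fin n, b (c k.castSucc) := by
    rw [Finset.sum_filter, Fin.sum_univ_castSucc]
    simp
  have hzs : (p : ℚ) ^ (∑ k : Fin n, b (c k.castSucc)) = ∏ k : Fin n, (p : ℚ) ^ b (c k.castSucc) :=
    zpow_sum_eq_prod hp0 _ _
  have hb' {q : ℚ} (hq : q ≠ 0) (S : Finset E) : q ^ b S * q ^ Fintype.card I =
      q ^ S.card * q ^ Nat.card (Quot (fun i j : I => ∃ e ∈ S, s e = i ∧ t e = j)) := by
    simp only [← zpow_natCast, ← zpow_add₀ hq, hb]
    congr 1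
    ring
  have hlast : (⟨n + 1 - 1, by omega⟩ : Fin (n + 1)) = Fin.last n := rfl
  rw [hlast, hsum, hzs, mul_mul_mul_comm, ← hb' hp1, ← Finset.prod_mul_distrib]
  simp_rw [← hb' hp0]
  rw [Finset.prod_mul_distrib, Finset.prod_const, Finset.card_univ, Fintype.card_fin, mul_pow,
    ← pow_mul, ← pow_mul, mul_comm n]
  ring
end

section
/- Let Γ = (I,E,s,t) be a quiver with finite nonempty vertex set I and finite edge set E which is connected and 2-edge-connected, meaning the graph (I,E) is connected and for every e ∈ E the graph (I, E∖{e}) is still connected. For a prime p and α ≥ 1 let A_{Γ,α} denote the number of isomorphism classes (orbits of the action (g·x)(e) = g(t(e))·x(e)·g(s(e))⁻¹ of ((ℤ/p^αℤ)^×)^I) of indecomposable 1-dimensional representations x : E → ℤ/p^αℤ, where x is indecomposable if the graph (I,{e : x(e) ≠ 0}) is connected. Then the sequence p^{−α·b(E)} A_{Γ,α} converges as α → ∞, with limit (1 − p^{−1})^{b(E)} · Σ Π_{j=1}^{β−1} (p^{b(E) − b(E'_j)} − 1)^{−1}, where the sum runs over all strictly increasing chains E'₁ ⊊ E'₂ ⊊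 ⋯ ⊊ E'_β = E of edge subsets of length β ≥ 1 (the empty product for β = 1 being 1), and b(E') = c(E') − |I| + |E'| with c(E') the number of connected components of (I,E'). -/
open Filter
open scoped Classical

/-- The sum of `∏ r (c j)` over the strictly increasing chains `c 0 ⊂ ⋯ ⊂ c β = F`, the product
being over the members of the chain other than `F`. -/
noncomputable def chainSum {E : Type*} [Fintype E] (r : Finset E → ℝ) (β : ℕ) (F : Finset E) : ℝ :=
  ∑ c ∈ Finset.univ.filter (fun c : Fin (β + 1) → Finset E =>
      StrictMono c ∧ c (Fin.last β) = F),
    ∏ j ∈ Finset.univ.filter (fun j : Fin (β + 1) => j ≠ Fin.last β), r (c j)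

theorem prod_filter_ne_last {n : ℕ} (f : Fin (n + 1) → ℝ) :
    ∏ j ∈ Finset.univ.filter (fun j : Fin (n + 1) => j ≠ Fin.last n), f j
      = ∏ j : Fin n, f j.castSucc := by
  rw [Finset.prod_filter, Fin.prod_univ_castSucc]
  simp [Fin.castSucc_ne_last]

theorem chainSum_zero {E : Type*} [Fintype E] (r : Finset E → ℝ) (F : Finset E) :
    chainSum r 0 F = 1 := by
  have h : Finset.univ.filter (fun c : Fin (0 + 1) → Finset E =>
      StrictMono c ∧ c (Fin.last 0) = F) = {fun _ => F} := by
    ext c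
    simp only [Finset.mem_filter, Finset.mem_univ, true_and, Finset.mem_singleton]
    constructor
    · rintro ⟨-, h⟩
      funext i
      rw [← h, Subsingleton.elim (α := Fin 1) i (Fin.last 0)]
    · rintro rfl
      exact ⟨Subsingleton.strictMono (α := Fin 1) _, rfl⟩
  rw [chainSum, h, Finset.sum_singleton, prod_filter_ne_last]
  simp

theorem strictMono_snoc {α : Type*} [Preorder α] {n : ℕ} {c : Fin (n + 1) → α} {a : α} :
    StrictMono (Fin.snoc c a : Fin (n + 2) → α) ↔ StrictMono c ∧ c (Fin.last n) < a := by
  constructor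
  · intro h
    constructor
    · intro i j hij
      simpa using h (Fin.castSucc_lt_castSucc_iff.2 hij)
    · simpa using h (Fin.castSucc_lt_last (Fin.last n))
  · rintro ⟨hc, ha⟩
    rw [Fin.strictMono_iff_lt_succ]
    intro i
    induction i using Fin.lastCases with
    | last => simpa [Fin.succ_last] using ha
    | cast i =>
      rw [Fin.succ_castSucc, Fin.snoc_castSucc, Fin.snoc_castSucc]
      exact hc Fin.castSucc_lt_succ

theorem chainSum_succ {E : Type*} [Fintype E] (r : Finset E → ℝ) (β : ℕ) (F : Finset E) :
    chainSum r (β + 1) F = ∑ G ∈ F.ssubsets, r G * chainSum r β G := by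
  have h : ∀ G : Finset E, r G * chainSum r β G =
      ∑ c ∈ Finset.univ.filter (fun c : Fin (β + 1) → Finset E =>
        StrictMono c ∧ c (Fin.last β) = G), ∏ j, r (c j) := by
    intro G
    rw [chainSum, Finset.mul_sum]
    refine Finset.sum_congr rfl fun c hc => ?_
    rw [prod_filter_ne_last, Fin.prod_univ_castSucc, (Finset.mem_filter.1 hc).2.2, mul_comm]
  simp only [h]
  rw [Finset.sum_sigma', chainSum]
  refine Finset.sum_bij' (fun c _ => ⟨Fin.init c (Fin.last β), Fin.init c⟩)
    (fun c _ => Fin.snoc c.2 F) ?_ ?_ ?_ ?_ ?_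
  · intro c hc
    simp only [Finset.mem_filter, Finset.mem_univ, true_and] at hc
    obtain ⟨hc, rfl⟩ := hc
    rw [← Fin.snoc_init_self c, strictMono_snoc] at hc
    simp only [Finset.mem_sigma, Finset.mem_ssubsets, Finset.mem_filter, Finset.mem_univ,
      true_and, and_true]
    exact ⟨hc.2, hc.1⟩
  · rintro ⟨G, c⟩ hc
    simp only [Finset.mem_sigma, Finset.mem_ssubsets, Finset.mem_filter, Finset.mem_univ,
      true_and] at hc
    obtain ⟨hG, hc, rfl⟩ := hc
    simp only [Finset.mem_filter, Finset.mem_univ, true_and, strictMono_snoc, Fin.snoc_last,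
      and_true]
    exact ⟨hc, hG⟩
  · intro c hc
    simp only [Finset.mem_filter, Finset.mem_univ, true_and] at hc
    obtain ⟨hc, rfl⟩ := hc
    exact Fin.snoc_init_self c
  · rintro ⟨G, c⟩ hc
    simp only [Finset.mem_sigma, Finset.mem_ssubsets, Finset.mem_filter, Finset.mem_univ,
      true_and] at hc
    obtain ⟨hG, hc, rfl⟩ := hc
    simp
  · intro c hc
    exact prod_filter_ne_last _

theorem chainSum_eq_zero {E : Type*} [Fintype E] (r : Finset E → ℝ) (β : ℕ) :
    ∀ F : Finset E, F.card < β → chainSum r β F = 0 := by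
  induction β with
  | zero => intro F h; omega
  | succ β ih =>
    intro F h
    rw [chainSum_succ]
    refine Finset.sum_eq_zero fun G hG => ?_
    have := Finset.card_lt_card (Finset.mem_ssubsets.1 hG)
    rw [ih G (by omega), mul_zero]

theorem finsum_chainSum_eq_sum_range {E : Type*} [Fintype E] (r : Finset E → ℝ) (F : Finset E)
    {N : ℕ} (hN : F.card < N) :
    ∑ᶠ β, chainSum r β F = ∑ β ∈ Finset.range N, chainSum r β F := by
  refine finsum_eq_sum_of_support_subset _ fun β hβ => ?_
  by_contra h
  simp only [Finset.coe_range, Set.mem_Iio, not_lt] at h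
  exact hβ (chainSum_eq_zero r β F (by omega))

theorem finsum_chainSum_eq {E : Type*} [Fintype E] (r : Finset E → ℝ) (F : Finset E) :
    ∑ᶠ β, chainSum r β F = 1 + ∑ G ∈ F.ssubsets, r G * ∑ᶠ β, chainSum r β G := by
  rw [finsum_chainSum_eq_sum_range r F (Nat.lt_succ_self _), Finset.sum_range_succ', chainSum_zero,
    add_comm]
  simp only [chainSum_succ]
  rw [Finset.sum_comm]
  congr 1
  refine Finset.sum_congr rfl fun G hG => ?_
  rw [finsum_chainSum_eq_sum_range r G (Finset.card_lt_card (Finset.mem_ssubsets.1 hG)),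
    Finset.mul_sum]

theorem hasSum_of_affine_recurrence {w σ : ℝ} {a u : ℕ → ℝ} (hw1 : w < 1)
    (ha : HasSum a σ) (ha0 : ∀ n, 0 ≤ a n) (hu0 : ∀ n, 0 ≤ u n) (u0 : u 0 = 1)
    (hu : ∀ n, u (n + 1) = w * u n + a n) : HasSum u ((1 + σ) / (1 - w)) := by
  have hsum : Summable u := by
    refine summable_of_sum_range_le (c := (1 + σ) / (1 - w)) hu0 fun n => ?_
    rw [le_div_iff₀ (by linarith)]
    have h1 : ∑ i ∈ Finset.range (n + 1), u i
        = 1 + w * ∑ i ∈ Finset.range n, u i + ∑ i ∈ Finset.range n, a i := by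
      rw [Finset.sum_range_succ', u0, Finset.mul_sum]
      simp only [hu, Finset.sum_add_distrib]
      ring
    have h2 : ∑ i ∈ Finset.range n, a i ≤ σ := sum_le_hasSum _ (fun i _ => ha0 i) ha
    rw [Finset.sum_range_succ] at h1
    linarith [hu0 n]
  have h := hsum.tsum_eq_zero_add
  simp only [hu] at h
  rw [u0, (hsum.mul_left w).tsum_add ha.summable, tsum_mul_left, ha.tsum_eq] at h
  have : ∑' n, u n = (1 + σ) / (1 - w) := by
    rw [eq_div_iff (by linarith)]
    linarith
  rw [← this]
  exact hsum.hasSum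

section Recurrence

variable {E : Type*} {w : Finset E → ℝ} {u : ℕ → Finset E → ℝ}

theorem powerset_recurrence_nonneg (hw0 : ∀ F, 0 < w F) (u0 : ∀ F, u 0 F = 1)
    (hu : ∀ n F, u (n + 1) F = ∑ G ∈ F.powerset, w G * u n G) (n : ℕ) : ∀ F, 0 ≤ u n F := by
  induction n with
  | zero => intro F; rw [u0]; exact zero_le_one
  | succ n ih =>
    intro F
    rw [hu]
    exact Finset.sum_nonneg fun G _ => mul_nonneg (hw0 G).le (ih G)

theorem powerset_recurrence_split
    (hu : ∀ n F, u (n + 1) F = ∑ G ∈ F.powerset, w G * u n G) (n : ℕ) (F : Finset E) :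
    u (n + 1) F = w F * u n F + ∑ G ∈ F.ssubsets, w G * u n G := by
  rw [hu, ← Finset.add_sum_erase _ _ (Finset.mem_powerset_self F)]
  congr 2

variable [Fintype E]

theorem powerset_recurrence_hasSum (hw0 : ∀ F, 0 < w F) (hw1 : ∀ F, F ≠ Finset.univ → w F < 1)
    (u0 : ∀ F, u 0 F = 1)
    (hu : ∀ n F, u (n + 1) F = ∑ G ∈ F.powerset, w G * u n G)
    {r : Finset E → ℝ} (hr : ∀ F, F ≠ Finset.univ → r F = w F / (1 - w F)) (F : Finset E) :
    F ≠ Finset.univ → HasSum (fun n => w F * u n F) (r F * ∑ᶠ β, chainSum r β F) := by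
  induction F using Finset.strongInduction with
  | H F ih =>
    intro hF
    have hnn := powerset_recurrence_nonneg hw0 u0 hu
    have ha : HasSum (fun n => ∑ G ∈ F.ssubsets, w G * u n G)
        (∑ G ∈ F.ssubsets, r G * ∑ᶠ β, chainSum r β G) :=
      hasSum_sum fun G hG => by
        have hG := Finset.mem_ssubsets.1 hG
        refine ih G hG ?_
        rintro rfl
        exact hG.2 (Finset.subset_univ F)
    have h := hasSum_of_affine_recurrence (hw1 F hF) ha
      (fun n => Finset.sum_nonneg fun G _ => mul_nonneg (hw0 G).le (hnn n G))
      (fun n => hnn n F) (u0 F) (fun n => powerset_recurrence_split hu n F)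
    rw [hr F hF, finsum_chainSum_eq, div_mul_eq_mul_div, ← mul_div_assoc']
    exact h.mul_left (w F)

theorem powerset_recurrence_tendsto_zero (hw0 : ∀ F, 0 < w F)
    (hw1 : ∀ F, F ≠ Finset.univ → w F < 1) (u0 : ∀ F, u 0 F = 1)
    (hu : ∀ n F, u (n + 1) F = ∑ G ∈ F.powerset, w G * u n G) {F : Finset E}
    (hF : F ≠ Finset.univ) : Tendsto (fun n => u n F) atTop (nhds 0) := by
  have h := (powerset_recurrence_hasSum hw0 hw1 u0 hu (fun _ _ => rfl) F hF).summable
  exact ((summable_mul_left_iff (hw0 F).ne').1 h).tendsto_atTop_zero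

theorem powerset_recurrence_tendsto (hw0 : ∀ F, 0 < w F) (hw1 : ∀ F, F ≠ Finset.univ → w F < 1)
    (hwu : w Finset.univ = 1) (u0 : ∀ F, u 0 F = 1)
    (hu : ∀ n F, u (n + 1) F = ∑ G ∈ F.powerset, w G * u n G)
    {r : Finset E → ℝ} (hr : ∀ F, F ≠ Finset.univ → r F = w F / (1 - w F)) :
    Tendsto (fun n => u n Finset.univ) atTop (nhds (∑ᶠ β, chainSum r β Finset.univ)) := by
  have ha : HasSum (fun n => ∑ G ∈ (Finset.univ : Finset E).ssubsets, w G * u n G)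
      (∑ G ∈ (Finset.univ : Finset E).ssubsets, r G * ∑ᶠ β, chainSum r β G) :=
    hasSum_sum fun G hG =>
      powerset_recurrence_hasSum hw0 hw1 u0 hu hr G (Finset.mem_ssubsets.1 hG).ne
  have h : ∀ n, u n Finset.univ = 1 +
      ∑ i ∈ Finset.range n, ∑ G ∈ (Finset.univ : Finset E).ssubsets, w G * u i G := by
    intro n
    induction n with
    | zero => simp [u0]
    | succ n ih =>
      rw [powerset_recurrence_split hu, hwu, one_mul, ih, Finset.sum_range_succ, add_assoc]
  simp only [h]
  rw [finsum_chainSum_eq]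
  exact ha.tendsto_sum_nat.const_add 1

end Recurrence

/-- The number of connected components of the graph with the given edge set. -/
noncomputable def comps {I E : Type*} (s t : E → I) (F : Finset E) : ℕ :=
  Nat.card (Quot (fun i j : I => ∃ e ∈ F, s e = i ∧ t e = j))

section Components

variable {I E : Type*} [Fintype I] (s t : E → I)

theorem comps_le_comps_insert_add_one (F : Finset E) (e : E) :
    comps s t F ≤ comps s t (insert e F) + 1 := by
  let R : Finset E → I → I → Prop := fun F i j => ∃ e ∈ F, s e = i ∧ t e = j
  let f : I → Quot (R F) := fun i =>
    if Quot.mk (R F) i = Quot.mk (R F) (s e) then Quot.mk (R F) (t e) else Quot.mk (R F) i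
  have hf : ∀ i j, R (insert e F) i j → f i = f j := by
    rintro i j ⟨e', he', rfl, rfl⟩
    rcases Finset.mem_insert.1 he' with rfl | he'
    · simp only [f, if_true]
      split_ifs <;> rfl
    · have : Quot.mk (R F) (s e') = Quot.mk (R F) (t e') := Quot.sound ⟨e', he', rfl, rfl⟩
      simp only [f, this]
  let π : Quot (R F) → Quot (R (insert e F)) :=
    Quot.map id fun i j ⟨e', he', h⟩ => ⟨e', Finset.mem_insert_of_mem he', h⟩
  let φ : Quot (R F) → Option (Quot (R (insert e F))) := fun a =>
    if a = Quot.mk _ (s e) then none else some (π a)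
  have hφ : Function.Injective φ := by
    intro a b hab
    by_cases ha : a = Quot.mk _ (s e) <;> by_cases hb : b = Quot.mk _ (s e)
    · rw [ha, hb]
    · simp [φ, ha, hb] at hab
    · simp [φ, ha, hb] at hab
    · simp only [φ, ha, hb, if_false, Option.some.injEq] at hab
      induction a using Quot.ind with | _ i
      induction b using Quot.ind with | _ j
      have := congrArg (Quot.lift f hf) hab
      change f i = f j at this
      simpa only [f, ha, hb, if_false] using this
  have := Nat.card_le_card_of_injective φ hφ
  rwa [Finite.card_option] at this

theorem comps_add_card_mono {F F' : Finset E} (h : F ⊆ F') :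
    comps s t F + F.card ≤ comps s t F' + F'.card := by
  have key : ∀ D : Finset E, comps s t F + F.card ≤ comps s t (D ∪ F) + (D ∪ F).card := by
    intro D
    induction D using Finset.induction_on with
    | empty => rw [Finset.empty_union]
    | insert e D _ ih =>
      rw [Finset.insert_union]
      by_cases he : e ∈ D ∪ F
      · rwa [Finset.insert_eq_of_mem he]
      · have := comps_le_comps_insert_add_one s t (D ∪ F) e
        rw [Finset.card_insert_of_notMem he]
        omega
  simpa [Finset.union_eq_left.2 h] using key F'

theorem card_edgewise_constant (X : Type*) [Finite X] (F : Finset E) :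
    Nat.card {h : I → X // ∀ e ∈ F, h (s e) = h (t e)} = Nat.card X ^ comps s t F := by
  let R : I → I → Prop := fun i j => ∃ e ∈ F, s e = i ∧ t e = j
  have eqv : {h : I → X // ∀ e ∈ F, h (s e) = h (t e)} ≃ (Quot R → X) :=
    { toFun := fun h => Quot.lift h.1 (by rintro i j ⟨e, he, rfl, rfl⟩; exact h.2 e he)
      invFun := fun k => ⟨fun i => k (Quot.mk _ i), fun e he =>
        congrArg k (Quot.sound ⟨e, he, rfl, rfl⟩)⟩
      left_inv := fun h => rfl
      right_inv := fun k => by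
        funext a
        induction a using Quot.ind
        rfl }
  rw [Nat.card_congr eqv, Nat.card_fun]
  rfl

end Components

/-- Splitting off the leading digit of a number with `n + 1` digits in base `p`. -/
def digitEquiv (p n : ℕ) : Fin p × Fin (p ^ n) ≃ Fin (p ^ (n + 1)) :=
  finProdFinEquiv.trans (finCongr (pow_succ' p n).symm)

theorem digitEquiv_val (p n : ℕ) (x : Fin p × Fin (p ^ n)) :
    (digitEquiv p n x : ℕ) = x.2 + p ^ n * x.1 := rfl

section Counting

variable {I E : Type*} [Fintype I] (s t : E → I) (p : ℕ)

theorem card_units_edgewise_congruent (hp : p.Prime) (C : ℕ → Finset E) (hC : Antitone C) (n : ℕ) :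
    Nat.card {g : I → Fin (p ^ (n + 1)) // (∀ i, ¬ p ∣ (g i : ℕ)) ∧
      ∀ k < n + 1, ∀ e ∈ C k, (g (s e) : ℕ) ≡ g (t e) [MOD p ^ (k + 1)]}
    = (p - 1) ^ comps s t (C 0) * ∏ k ∈ Finset.range n, p ^ comps s t (C (k + 1)) := by
  have hpos : 0 < p := hp.pos
  have fin_congr : ∀ (m : ℕ) (a b : Fin m), (a : ℕ) ≡ b [MOD m] ↔ a = b := by
    intro m a b
    rw [Nat.ModEq, Nat.mod_eq_of_lt a.2, Nat.mod_eq_of_lt b.2, Fin.val_inj]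
  induction n with
  | zero =>
    rw [Finset.prod_range_zero, mul_one]
    have hcard : Nat.card {a : Fin (p ^ (0 + 1)) // ¬ p ∣ (a : ℕ)} = p - 1 := by
      have : NeZero (p ^ (0 + 1)) := ⟨by simpa using hpos.ne'⟩
      have h : ∀ a : Fin (p ^ (0 + 1)), ¬ p ∣ (a : ℕ) ↔ a ≠ 0 := by
        intro a
        have : (a : ℕ) < p := by simpa using a.2
        rw [not_iff_not, Fin.ext_iff, Fin.val_zero]
        exact ⟨fun h => Nat.eq_zero_of_dvd_of_lt h this, fun h => by rw [h]; exact dvd_zero _⟩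
      rw [Nat.card_congr (Equiv.subtypeEquivRight h), Nat.card_eq_fintype_card,
        Fintype.card_subtype_compl]
      simp
    rw [← hcard, ← card_edgewise_constant]
    refine Nat.card_congr
      { toFun := fun g => ⟨fun i => ⟨g.1 i, g.2.1 i⟩, fun e he => Subtype.ext ?_⟩
        invFun := fun h => ⟨fun i => (h.1 i).1, fun i => (h.1 i).2, fun k hk e he => ?_⟩
        left_inv := fun g => rfl
        right_inv := fun h => rfl }
    · exact (fin_congr _ _ _).1 (g.2.2 0 Nat.one_pos e he)
    · obtain rfl : k = 0 := by omega
      exact congrArg (fun a => (a.1 : ℕ) % p ^ (0 + 1)) (h.2 e he)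
  | succ n ih =>
    rw [Finset.prod_range_succ, ← mul_assoc, ← ih, mul_comm,
      show p ^ comps s t (C (n + 1)) = Nat.card (Fin p) ^ comps s t (C (n + 1)) by simp,
      ← card_edgewise_constant, ← Nat.card_prod]
    let D := digitEquiv p (n + 1)
    have low : ∀ x k, k ≤ n + 1 → (D x : ℕ) ≡ x.2 [MOD p ^ k] := by
      intro x k hk
      rw [digitEquiv_val]
      have : p ^ (n + 1) * (x.1 : ℕ) ≡ 0 [MOD p ^ k] :=
        (Nat.modEq_zero_iff_dvd).2 ((pow_dvd_pow p hk).mul_right _)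
      simpa using this.add_left (x.2 : ℕ)
    have hdvd : ∀ x, p ∣ (D x : ℕ) ↔ p ∣ (x.2 : ℕ) := fun x =>
      Nat.ModEq.dvd_iff (low x 1 (by omega)) (by simp)
    refine Nat.card_congr (Equiv.symm
      { toFun := fun gh => ⟨fun i => D (gh.1.1 i, gh.2.1 i), fun i => ?_, fun k hk e he => ?_⟩
        invFun := fun g => ⟨⟨fun i => (D.symm (g.1 i)).1, fun e he => ?_⟩,
          ⟨fun i => (D.symm (g.1 i)).2, fun i => ?_, fun k hk e he => ?_⟩⟩
        left_inv := fun gh => by simp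
        right_inv := fun g => by simp })
    · rw [hdvd]
      exact gh.2.2.1 i
    · rcases Nat.lt_succ_iff_lt_or_eq.1 hk with hk | rfl
      · exact ((low _ _ (by omega)).trans (gh.2.2.2 k hk e he)).trans (low _ _ (by omega)).symm
      · rw [fin_congr, D.apply_eq_iff_eq]
        have h2 := gh.2.2.2 n (by omega) e (hC (by omega) he)
        rw [fin_congr] at h2
        rw [h2, gh.1.2 e he]
    · have h := g.2.2 (n + 1) (by omega) e he
      rw [fin_congr] at h
      simp only [h]
    · rw [← hdvd, D.apply_symm_apply]
      exact g.2.1 i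
    · have h := g.2.2 k (by omega) e he
      have h1 := low (D.symm (g.1 (s e))) (k + 1) (by omega)
      have h2 := low (D.symm (g.1 (t e))) (k + 1) (by omega)
      rw [D.apply_symm_apply] at h1 h2
      exact (h1.symm.trans h).trans h2

end Counting

section Representations

variable {I E : Type*} [Fintype E] (s t : E → I) (p : ℕ)

/-- The set of edges where `p ^ k * x` does not vanish modulo `p ^ n`. -/
noncomputable def level (n k : ℕ) (x : E → Fin (p ^ n)) : Finset E :=
  Finset.univ.filter fun e => ¬ p ^ n ∣ p ^ k * (x e : ℕ)

/-- The sum over the chains `F₁ ⊆ ⋯ ⊆ Fₙ ⊆ F` of `∏ p ^ (|Fⱼ| + c(Fⱼ))`. -/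
noncomputable def levelSum {I E : Type*} (s t : E → I) (p : ℕ) : ℕ → Finset E → ℕ
  | 0, _ => 1
  | n + 1, F => ∑ G ∈ F.powerset, p ^ (G.card + comps s t G) * levelSum s t p n G

theorem card_filter_prescribed_support (hp : 0 < p) (F G : Finset E) :
    (Finset.univ.filter fun h : E → Fin p =>
      (Finset.univ.filter fun e => e ∈ G ∨ (h e : ℕ) ≠ 0) = F).card
    = if G ∈ F.powerset then p ^ G.card * (p - 1) ^ (F \ G).card else 0 := by
  have : NeZero p := ⟨hp.ne'⟩
  split_ifs with hGF
  · rw [Finset.mem_powerset] at hGF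
    let S : E → Finset (Fin p) := fun e =>
      if e ∈ G then Finset.univ else if e ∈ F then Finset.univ.erase 0 else {0}
    have hS : (Finset.univ.filter fun h : E → Fin p =>
      (Finset.univ.filter fun e => e ∈ G ∨ (h e : ℕ) ≠ 0) = F) = Fintype.piFinset S := by
      ext h
      simp only [Finset.mem_filter, Finset.mem_univ, true_and, Fintype.mem_piFinset,
        Finset.ext_iff]
      refine forall_congr' fun e => ?_
      have h0 : (h e : ℕ) ≠ 0 ↔ h e ≠ 0 := by rw [Ne, Fin.val_eq_zero_iff]
      by_cases hG : e ∈ G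
      · simp [S, hG, hGF hG]
      · by_cases hF : e ∈ F <;> simp [S, hG, hF]
    have hcard : ∀ e, (S e).card =
        (if e ∈ G then p else 1) * (if e ∈ F \ G then p - 1 else 1) := by
      intro e
      by_cases hG : e ∈ G
      · simp [S, hG]
      · by_cases hF : e ∈ F <;> simp [S, hG, hF]
    rw [hS, Fintype.card_piFinset]
    simp only [hcard]
    rw [Finset.prod_mul_distrib, Finset.prod_ite_mem, Finset.prod_ite_mem, Finset.univ_inter,
      Finset.univ_inter, Finset.prod_const, Finset.prod_const]
  · rw [Finset.card_eq_zero, Finset.filter_eq_empty_iff]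
    rintro h - rfl
    refine hGF (Finset.mem_powerset.2 fun e he => ?_)
    simp [he]

theorem level_zero (n : ℕ) (x : E → Fin (p ^ n)) :
    level p n 0 x = Finset.univ.filter fun e => (x e : ℕ) ≠ 0 := by
  refine Finset.filter_congr fun e _ => not_congr ?_
  rw [pow_zero, one_mul]
  exact ⟨fun h => Nat.eq_zero_of_dvd_of_lt h (x e).2, fun h => h ▸ dvd_zero _⟩

theorem level_succ_digitEquiv (hp : 0 < p) (n k : ℕ) (h : E → Fin p) (x : E → Fin (p ^ n)) :
    level p (n + 1) (k + 1) (fun e => digitEquiv p n (h e, x e)) = level p n k x := by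
  refine Finset.filter_congr fun e _ => not_congr ?_
  rw [digitEquiv_val, pow_succ, pow_succ, mul_add, ← Nat.dvd_add_iff_left, mul_right_comm]
  · exact Nat.mul_dvd_mul_iff_right hp
  · exact ⟨p ^ k * h e, by ring⟩

theorem level_zero_digitEquiv (hp : 0 < p) (n : ℕ) (h : E → Fin p) (x : E → Fin (p ^ n)) :
    level p (n + 1) 0 (fun e => digitEquiv p n (h e, x e))
      = Finset.univ.filter fun e => e ∈ level p n 0 x ∨ (h e : ℕ) ≠ 0 := by
  rw [level_zero, level_zero]
  refine Finset.filter_congr fun e _ => ?_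
  have : p ^ n ≠ 0 := (pow_pos hp n).ne'
  simp only [digitEquiv_val, Finset.mem_filter, Finset.mem_univ, true_and]
  rw [Ne, Nat.add_eq_zero_iff, Nat.mul_eq_zero]
  tauto

/-- Functions with values in numbers with `n + 1` digits, with the leading digit split off. -/
def digitFunEquiv (E : Type*) (p n : ℕ) :
    (E → Fin p) × (E → Fin (p ^ n)) ≃ (E → Fin (p ^ (n + 1))) :=
  (Equiv.arrowProdEquivProdArrow E (fun _ => Fin p) (fun _ => Fin (p ^ n))).symm.trans
    (Equiv.arrowCongr (Equiv.refl E) (digitEquiv p n))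

theorem sum_level_zero_eq (hp : 0 < p) (n : ℕ) (F : Finset E) (f : (E → Fin (p ^ (n + 1))) → ℕ)
    (f' : (E → Fin (p ^ n)) → ℕ)
    (hf : ∀ (h : E → Fin p) x, f (fun e => digitEquiv p n (h e, x e)) = f' x) :
    ∑ x with level p (n + 1) 0 x = F, f x
      = ∑ G ∈ F.powerset, p ^ G.card * (p - 1) ^ (F \ G).card *
          ∑ x with level p n 0 x = G, f' x := by
  rw [Finset.sum_filter, ← Fintype.sum_equiv (digitFunEquiv E p n)
    (fun y => if (Finset.univ.filter fun e => e ∈ level p n 0 y.2 ∨ (y.1 e : ℕ) ≠ 0) = F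
      then f' y.2 else 0), Fintype.sum_prod_type_right]
  · simp only [← Finset.sum_filter, Finset.sum_const, card_filter_prescribed_support p hp,
      smul_eq_mul, ite_mul, zero_mul]
    simp only [Finset.sum_filter, Finset.mul_sum]
    rw [Finset.sum_comm]
    refine Finset.sum_congr rfl fun x _ => ?_
    simp only [mul_ite, mul_zero]
    rw [Finset.sum_ite_eq]
  · rintro ⟨h, x⟩
    change _ = if level p (n + 1) 0 (fun e => digitEquiv p n (h e, x e)) = F
      then f (fun e => digitEquiv p n (h e, x e)) else 0
    rw [level_zero_digitEquiv p hp, hf]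

theorem sum_prod_level (hp : 0 < p) (n : ℕ) : ∀ F : Finset E,
    ∑ x with level p (n + 1) 0 x = F,
        ∏ k ∈ Finset.range n, p ^ comps s t (level p (n + 1) (k + 1) x)
      = (p - 1) ^ F.card * levelSum s t p n F := by
  induction n with
  | zero =>
    intro F
    rw [sum_level_zero_eq p hp 0 F _ (fun _ => 1) (fun h x => by simp)]
    have : ∀ x : E → Fin (p ^ 0), level p 0 0 x = ∅ := fun x => by simp [level]
    simp only [this, levelSum]
    rw [Finset.sum_eq_single_of_mem ∅ (Finset.empty_mem_powerset F)]
    · have hc : (Finset.univ : Finset (E → Fin (p ^ 0))).card = 1 := by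
        rw [Finset.card_univ, Fintype.card_pi]
        simp
      simp only [Finset.filter_true, Finset.sum_const, hc]
      simp
    · intro G _ hG
      simp only [hG.symm, Finset.filter_false, Finset.sum_empty, mul_zero]
  | succ n ih =>
    intro F
    rw [sum_level_zero_eq p hp (n + 1) F _ (fun x => p ^ comps s t (level p (n + 1) 0 x) *
      ∏ k ∈ Finset.range n, p ^ comps s t (level p (n + 1) (k + 1) x))]
    · rw [levelSum, Finset.mul_sum]
      refine Finset.sum_congr rfl fun G hG => ?_
      have h : ∑ x with level p (n + 1) 0 x = G, p ^ comps s t (level p (n + 1) 0 x) *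
          ∏ k ∈ Finset.range n, p ^ comps s t (level p (n + 1) (k + 1) x)
          = p ^ comps s t G * ((p - 1) ^ G.card * levelSum s t p n G) := by
        rw [← ih, Finset.mul_sum]
        refine Finset.sum_congr rfl fun x hx => ?_
        rw [(Finset.mem_filter.1 hx).2]
      rw [h, ← Finset.card_sdiff_add_card_eq_card (Finset.mem_powerset.1 hG), pow_add, pow_add]
      ring
    · intro h x
      rw [Finset.prod_range_succ', mul_comm]
      simp only [level_succ_digitEquiv p hp]

end Representations

section Orbits

theorem mul_modEq_mul_iff_forall {p : ℕ} (hp : p.Prime) (m a b y : ℕ) :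
    a * y ≡ b * y [MOD p ^ m] ↔
      ∀ k < m, ¬ p ^ m ∣ p ^ k * y → a ≡ b [MOD p ^ (k + 1)] := by
  by_cases hy : p ^ m ∣ y
  · refine ⟨fun _ k _ h => absurd (hy.mul_left _) h, fun _ => ?_⟩
    exact ((Nat.modEq_zero_iff_dvd).2 (hy.mul_left a)).trans
      ((Nat.modEq_zero_iff_dvd).2 (hy.mul_left b)).symm
  have hy0 : y ≠ 0 := by rintro rfl; exact hy (dvd_zero _)
  obtain ⟨v, u, hu, rfl⟩ := Nat.exists_eq_pow_mul_and_not_dvd hy0 p hp.ne_one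
  have hv : v < m := by
    by_contra h
    exact hy ((pow_dvd_pow p (not_lt.1 h)).mul_right u)
  have hcop : ∀ k, Nat.Coprime (p ^ k) u := fun k =>
    Nat.Coprime.pow_left k ((hp.coprime_iff_not_dvd).2 hu)
  have hdvd : ∀ k, p ^ m ∣ p ^ k * (p ^ v * u) ↔ m ≤ k + v := by
    intro k
    rw [← mul_assoc, ← pow_add, (hcop m).dvd_mul_right, Nat.pow_dvd_pow_iff_le_right hp.one_lt]
  have hl : a * (p ^ v * u) ≡ b * (p ^ v * u) [MOD p ^ m] ↔ a ≡ b [MOD p ^ (m - v)] := by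
    have hm : p ^ m = p ^ (m - v) * p ^ v := by rw [← pow_add, Nat.sub_add_cancel hv.le]
    rw [mul_left_comm, mul_left_comm b, hm, mul_comm (p ^ (m - v)),
      Nat.ModEq.mul_left_cancel_iff' (pow_pos hp.pos v).ne']
    exact ⟨Nat.ModEq.cancel_right_of_coprime (hcop _), fun h => h.mul_right u⟩
  rw [hl]
  simp only [hdvd, not_le]
  constructor
  · intro h k _ hk
    exact h.of_dvd (pow_dvd_pow p (by omega))
  · intro h
    have := h (m - v - 1) (by omega) (by omega)
    rwa [Nat.sub_add_cancel (by omega)] at this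

variable {I E : Type*} [Fintype I] [Fintype E] (s t : E → I) {p : ℕ}

/-- The least non-negative representatives of the residue classes modulo `N`. -/
def zmodEquivFin (N : ℕ) [NeZero N] : ZMod N ≃ Fin N where
  toFun x := ⟨x.val, x.val_lt⟩
  invFun a := (a : ℕ)
  left_inv x := ZMod.natCast_zmod_val x
  right_inv a := Fin.ext (ZMod.val_cast_of_lt a.2)

theorem card_stabilizer (hp : p.Prime) (n : ℕ) [NeZero (p ^ (n + 1))]
    (x : E → ZMod (p ^ (n + 1))) :
    Nat.card {g : I → (ZMod (p ^ (n + 1)))ˣ //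
      ∀ e, (g (t e) : ZMod (p ^ (n + 1))) * x e * ((g (s e))⁻¹ : (ZMod (p ^ (n + 1)))ˣ) = x e}
    = (p - 1) ^ comps s t (level p (n + 1) 0 fun e => zmodEquivFin _ (x e)) *
        ∏ k ∈ Finset.range n,
          p ^ comps s t (level p (n + 1) (k + 1) fun e => zmodEquivFin _ (x e)) := by
  have key : ∀ (a b : ℕ) (u v : (ZMod (p ^ (n + 1)))ˣ) (e : E), (u : ZMod (p ^ (n + 1))) = a →
      (v : ZMod (p ^ (n + 1))) = b →
      ((v : ZMod (p ^ (n + 1))) * x e * ((u⁻¹ : (ZMod (p ^ (n + 1)))ˣ)) = x e ↔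
        ∀ k < n + 1, e ∈ level p (n + 1) k (fun e => zmodEquivFin _ (x e)) →
          a ≡ b [MOD p ^ (k + 1)]) := by
    intro a b u v e hu hv
    have h := mul_modEq_mul_iff_forall hp (n + 1) a b (x e).val
    simp only [level, Finset.mem_filter, Finset.mem_univ, true_and]
    rw [Units.mul_inv_eq_iff_eq_mul, hu, hv]
    refine Iff.trans ?_ h
    rw [← ZMod.natCast_eq_natCast_iff, Nat.cast_mul, Nat.cast_mul, ZMod.natCast_zmod_val,
      mul_comm (x e), eq_comm]
  have hC : Antitone fun k => level p (n + 1) k fun e => zmodEquivFin _ (x e) := by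
    intro j k hjk e he
    simp only [level, Finset.mem_filter, Finset.mem_univ, true_and] at he ⊢
    exact fun h => he (h.trans (mul_dvd_mul_right (pow_dvd_pow p hjk) _))
  rw [← card_units_edgewise_congruent s t p hp _ hC n]
  have hcop : ∀ a : ℕ, ¬ p ∣ a → Nat.Coprime a (p ^ (n + 1)) := fun a ha =>
    (Nat.Coprime.pow_left _ ((hp.coprime_iff_not_dvd).2 ha)).symm
  refine Nat.card_congr
    { toFun := fun g => ⟨fun i => zmodEquivFin _ (g.1 i), fun i hi => ?_, fun k hk e he => ?_⟩
      invFun := fun g => ⟨fun i => ZMod.unitOfCoprime (g.1 i) (hcop _ (g.2.1 i)), fun e => ?_⟩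
      left_inv := fun g => Subtype.ext (funext fun i => Units.ext ?_)
      right_inv := fun g => Subtype.ext (funext fun i => ?_) }
  · have h1 := ZMod.val_coe_unit_coprime (g.1 i)
    exact hp.one_lt.ne' (Nat.eq_one_of_dvd_coprimes h1 hi (dvd_pow_self p n.succ_ne_zero))
  · exact (key _ _ (g.1 (s e)) (g.1 (t e)) e (ZMod.natCast_zmod_val _).symm
      (ZMod.natCast_zmod_val _).symm).1 (g.2 e) k hk he
  · exact (key _ _ _ _ e (ZMod.coe_unitOfCoprime _ _) (ZMod.coe_unitOfCoprime _ _)).2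
      fun k hk he => g.2.2 k hk e he
  · exact (zmodEquivFin _).symm_apply_apply _
  · exact (zmodEquivFin _).apply_symm_apply _

theorem card_orbits_mul_card_group (N : ℕ) [NeZero N] (P : Finset E → Prop) :
    Nat.card (Quot (fun x y : {x : E → ZMod N // P (Finset.univ.filter (fun e => x e ≠ 0))} =>
      ∃ g : I → (ZMod N)ˣ, ∀ e : E,
        y.1 e = (g (t e) : ZMod N) * x.1 e * ((g (s e))⁻¹ : (ZMod N)ˣ)))
        * N.totient ^ Fintype.card I
      = ∑ x : E → ZMod N with P (Finset.univ.filter (fun e => x e ≠ 0)),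
        Nat.card {g : I → (ZMod N)ˣ //
          ∀ e, (g (t e) : ZMod N) * x e * ((g (s e))⁻¹ : (ZMod N)ˣ) = x e} := by
  let X := {x : E → ZMod N // P (Finset.univ.filter (fun e => x e ≠ 0))}
  let act : MulAction (I → (ZMod N)ˣ) X :=
    { smul := fun g x => ⟨fun e => (g (t e) : ZMod N) * x.1 e * ((g (s e))⁻¹ : (ZMod N)ˣ), by
        have h : ∀ e, (g (t e) : ZMod N) * x.1 e * ((g (s e))⁻¹ : (ZMod N)ˣ) ≠ 0 ↔ x.1 e ≠ 0 :=
          fun e => by rw [Ne, Units.mul_left_eq_zero, Units.mul_right_eq_zero]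
        simpa only [h] using x.2⟩
      one_smul := fun x => Subtype.ext (funext fun e => by
        change ((1 : (ZMod N)ˣ) : ZMod N) * x.1 e * (((1 : (ZMod N)ˣ)⁻¹ : (ZMod N)ˣ)) = x.1 e
        simp)
      mul_smul := fun g h x => Subtype.ext (funext fun e => by
        change ((g (t e) * h (t e) : (ZMod N)ˣ) : ZMod N) * x.1 e *
            (((g (s e) * h (s e))⁻¹ : (ZMod N)ˣ)) =
          (g (t e) : ZMod N) * ((h (t e) : ZMod N) * x.1 e * ((h (s e))⁻¹ : (ZMod N)ˣ)) *
            ((g (s e))⁻¹ : (ZMod N)ˣ)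
        rw [mul_inv, Units.val_mul, Units.val_mul]
        ring) }
  have horb : Nat.card (Quotient (MulAction.orbitRel (I → (ZMod N)ˣ) X)) = Nat.card (Quot
      (fun x y : X => ∃ g : I → (ZMod N)ˣ, ∀ e : E,
        y.1 e = (g (t e) : ZMod N) * x.1 e * ((g (s e))⁻¹ : (ZMod N)ˣ))) := by
    refine Nat.card_congr (Quot.congrRight fun x y => ?_)
    refine ((MulAction.orbitRel _ X).comm').trans (exists_congr fun g => ?_)
    rw [Subtype.ext_iff, funext_iff]
    exact forall_congr' fun e => eq_comm
  have hG : Nat.card (I → (ZMod N)ˣ) = N.totient ^ Fintype.card I := by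
    rw [Nat.card_fun, Nat.card_eq_fintype_card, ZMod.card_units_eq_totient,
      Nat.card_eq_fintype_card]
  have hswap : (Σ g : I → (ZMod N)ˣ, MulAction.fixedBy X g) ≃
      (Σ x : X, {g : I → (ZMod N)ˣ //
          ∀ e, (g (t e) : ZMod N) * x.1 e * ((g (s e))⁻¹ : (ZMod N)ˣ) = x.1 e}) :=
    { toFun := fun a => ⟨a.2.1, a.1, fun e => congrFun (congrArg Subtype.val a.2.2) e⟩
      invFun := fun a => ⟨a.2.1, a.1, Subtype.ext (funext a.2.2)⟩
      left_inv := fun _ => rfl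
      right_inv := fun _ => rfl }
  change Nat.card (Quot (fun x y : X => _)) * _ = _
  rw [← horb, ← hG, ← Nat.card_prod,
    ← Nat.card_congr (MulAction.sigmaFixedByEquivOrbitsProdGroup (I → (ZMod N)ˣ) X),
    Nat.card_congr hswap, Nat.card_sigma]
  exact (Finset.sum_subtype _ (fun x => by simp) fun x : E → ZMod N =>
    Nat.card {g : I → (ZMod N)ˣ //
      ∀ e, (g (t e) : ZMod N) * x e * ((g (s e))⁻¹ : (ZMod N)ˣ) = x e}).symm

theorem card_orbits_mul (hp : p.Prime) (P : Finset E → Prop) (n : ℕ) :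
    Nat.card (Quot (fun x y :
        {x : E → ZMod (p ^ (n + 1)) // P (Finset.univ.filter (fun e => x e ≠ 0))} =>
      ∃ g : I → (ZMod (p ^ (n + 1)))ˣ, ∀ e : E,
        y.1 e = (g (t e) : ZMod (p ^ (n + 1))) * x.1 e * ((g (s e))⁻¹ : (ZMod (p ^ (n + 1)))ˣ)))
        * (p ^ n * (p - 1)) ^ Fintype.card I
      = ∑ F : Finset E with P F, (p - 1) ^ (comps s t F + F.card) * levelSum s t p n F := by
  have : NeZero (p ^ (n + 1)) := ⟨(pow_pos hp.pos _).ne'⟩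
  have hsupp : ∀ x : E → ZMod (p ^ (n + 1)), Finset.univ.filter (fun e => x e ≠ 0) =
      level p (n + 1) 0 fun e => zmodEquivFin _ (x e) := by
    intro x
    rw [level_zero]
    exact Finset.filter_congr fun e _ => not_congr (ZMod.val_eq_zero _).symm
  rw [← Nat.totient_prime_pow_succ hp, card_orbits_mul_card_group]
  simp only [card_stabilizer s t hp n, hsupp]
  rw [Finset.sum_filter]
  refine (Fintype.sum_equiv ((Equiv.refl E).arrowCongr (zmodEquivFin _)) _
    (fun y : E → Fin (p ^ (n + 1)) => if P (level p (n + 1) 0 y) then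
      (p - 1) ^ comps s t (level p (n + 1) 0 y) * ∏ k ∈ Finset.range n,
          p ^ comps s t (level p (n + 1) (k + 1) y) else 0) (fun x => rfl)).trans ?_
  rw [← Finset.sum_filter, ← Finset.sum_fiberwise_of_maps_to (g := level p (n + 1) 0)
      (t := Finset.univ.filter P)
      (fun y hy => Finset.mem_filter.2 ⟨Finset.mem_univ _, (Finset.mem_filter.1 hy).2⟩)]
  refine Finset.sum_congr rfl fun F hF => ?_
  rw [pow_add (p - 1) (comps s t F), mul_assoc, ← sum_prod_level s t p hp.pos,
    Finset.mul_sum, Finset.filter_filter]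
  refine Finset.sum_congr ?_ fun y hy => by rw [(Finset.mem_filter.1 hy).2]
  refine Finset.filter_congr fun y _ => ?_
  exact ⟨And.right, fun h => ⟨h ▸ (Finset.mem_filter.1 hF).2, h⟩⟩

end Orbits

theorem stmt_16 {I E : Type*} [Fintype I] [Fintype E] [Nonempty I] (s t : E → I)
    (p : ℕ) (hp : p.Prime)
    (conn : Finset E → Prop)
    (hconn : ∀ E' : Finset E, conn E' ↔
      Nat.card (Quot (fun i j : I => ∃ e ∈ E', s e = i ∧ t e = j)) = 1)
    (b : Finset E → ℤ)
    (hb : ∀ E' : Finset E, b E' =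
      (Nat.card (Quot (fun i j : I => ∃ e ∈ E', s e = i ∧ t e = j)) : ℤ)
        - Fintype.card I + E'.card)
    (hconn_univ : conn Finset.univ)
    (h2conn : ∀ e : E, conn (Finset.univ.erase e))
    (A : ℕ → ℕ)
    (hA : ∀ α : ℕ, A α = Nat.card (Quot (fun x y :
        {x : E → ZMod (p ^ α) // conn (Finset.univ.filter (fun e => x e ≠ 0))} =>
      ∃ g : I → (ZMod (p ^ α))ˣ, ∀ e : E,
        y.1 e = (g (t e) : ZMod (p ^ α)) * x.1 e * ((g (s e))⁻¹ : (ZMod (p ^ α))ˣ)))) :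
    Tendsto (fun α : ℕ => (p : ℝ) ^ (-(α : ℤ) * b Finset.univ) * (A α : ℝ)) atTop
      (nhds ((1 - (p : ℝ)⁻¹) ^ (b Finset.univ) *
        ∑ᶠ β : ℕ, ∑ c ∈ Finset.univ.filter (fun c : Fin (β + 1) → Finset E =>
            StrictMono c ∧ c (Fin.last β) = Finset.univ),
          ∏ j ∈ Finset.univ.filter (fun j : Fin (β + 1) => j ≠ Fin.last β),
            ((p : ℝ) ^ (b Finset.univ - b (c j)) - 1)⁻¹)) := by
  have hp0 : (p : ℝ) ≠ 0 := Nat.cast_ne_zero.2 hp.ne_zero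
  have hp1 : (1 : ℝ) < p := Nat.one_lt_cast.2 hp.one_lt
  have hq0 : (p : ℝ) - 1 ≠ 0 := (sub_pos.2 hp1).ne'
  set B := b Finset.univ with hB
  have hbc : ∀ F, b F = comps s t F - Fintype.card I + F.card := hb
  have hcu : comps s t Finset.univ = 1 := (hconn _).1 hconn_univ
  have hlt : ∀ F, F ≠ Finset.univ → b F < B := by
    intro F hF
    obtain ⟨e, he⟩ : ∃ e, e ∉ F := by
      by_contra! h
      exact hF (Finset.eq_univ_iff_forall.2 h)
    have h1 := comps_add_card_mono s t (F := F) (F' := Finset.univ.erase e)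
      (fun a ha => Finset.mem_erase.2 ⟨fun h => he (h ▸ ha), Finset.mem_univ a⟩)
    have h2 : comps s t (Finset.univ.erase e) = 1 := (hconn _).1 (h2conn e)
    have h3 := Finset.card_erase_add_one (Finset.mem_univ e)
    rw [hB, hbc, hbc, hcu]
    omega
  let w : Finset E → ℝ := fun F => (p : ℝ) ^ (b F - B)
  let u : ℕ → Finset E → ℝ := fun n F =>
    levelSum s t p n F * (p : ℝ) ^ (-(n : ℤ) * (Fintype.card I + B))
  let r : Finset E → ℝ := fun F => ((p : ℝ) ^ (B - b F) - 1)⁻¹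
  have hw0 : ∀ F, 0 < w F := fun F => zpow_pos (by positivity) _
  have hw1 : ∀ F, F ≠ Finset.univ → w F < 1 := fun F hF =>
    zpow_lt_one_of_neg₀ hp1 (by have := hlt F hF; omega)
  have hwu : w Finset.univ = 1 := by simp [w, B]
  have u0 : ∀ F, u 0 F = 1 := fun F => by simp [u, levelSum]
  have hu : ∀ n F, u (n + 1) F = ∑ G ∈ F.powerset, w G * u n G := by
    intro n F
    simp only [u, w, levelSum, Nat.cast_sum, Finset.sum_mul]
    refine Finset.sum_congr rfl fun G _ => ?_
    have h : (p : ℝ) ^ (b G - B) * (p : ℝ) ^ (-(n : ℤ) * (Fintype.card I + B)) =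
        (p : ℝ) ^ (G.card + comps s t G) *
          (p : ℝ) ^ (-((n + 1 : ℕ) : ℤ) * (Fintype.card I + B)) := by
      rw [← zpow_natCast, ← zpow_add₀ hp0, ← zpow_add₀ hp0, hbc]
      congr 1
      push_cast
      ring
    rw [mul_left_comm, h]
    push_cast
    ring
  have hr : ∀ F, F ≠ Finset.univ → r F = w F / (1 - w F) := by
    intro F hF
    have h : w F = ((p : ℝ) ^ (B - b F))⁻¹ := by rw [← zpow_neg, neg_sub]
    have hq : (1 : ℝ) < (p : ℝ) ^ (B - b F) :=
      one_lt_zpow₀ hp1 (by have := hlt F hF; omega)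
    have : (p : ℝ) ^ (B - b F) - 1 ≠ 0 := (sub_pos.2 hq).ne'
    simp only [r, h]
    field_simp
  have hA' : ∀ n : ℕ, (p : ℝ) ^ (-((n + 1 : ℕ) : ℤ) * B) * (A (n + 1) : ℝ) =
      ∑ F : Finset E with conn F, ((p : ℝ) - 1) ^ b F * (p : ℝ) ^ (-B) * u n F := by
    intro n
    have h := card_orbits_mul s t hp conn n
    rw [← hA] at h
    have h' := congrArg (Nat.cast : ℕ → ℝ) h
    push_cast [Nat.cast_sub hp.one_lt.le] at h'
    have hne : ((p : ℝ) ^ n * (p - 1)) ^ Fintype.card I ≠ 0 :=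
      pow_ne_zero _ (mul_ne_zero (pow_ne_zero _ hp0) hq0)
    rw [← eq_div_iff hne] at h'
    rw [h', Finset.sum_div, Finset.mul_sum]
    refine Finset.sum_congr rfl fun F _ => ?_
    have e1 : ((p : ℝ) - 1) ^ b F =
        ((p : ℝ) - 1) ^ (comps s t F + F.card) / ((p : ℝ) - 1) ^ Fintype.card I := by
      rw [← zpow_natCast, ← zpow_natCast, ← zpow_sub₀ hq0, hbc]
      congr 1
      push_cast
      ring
    have e2 : (p : ℝ) ^ (-B) * (p : ℝ) ^ (-(n : ℤ) * (Fintype.card I + B)) =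
        (p : ℝ) ^ (-((n + 1 : ℕ) : ℤ) * B) / ((p : ℝ) ^ n) ^ Fintype.card I := by
      rw [← pow_mul, ← zpow_natCast, ← zpow_sub₀ hp0, ← zpow_add₀ hp0]
      congr 1
      push_cast
      ring
    simp only [u]
    rw [mul_assoc, mul_left_comm (_ ^ (-B)), e2, e1, mul_pow]
    field_simp
  refine (tendsto_add_atTop_iff_nat 1).1 ?_
  simp only [hA']
  have hlim : ∀ F ∈ Finset.univ.filter conn,
      Tendsto (fun n => ((p : ℝ) - 1) ^ b F * (p : ℝ) ^ (-B) * u n F) atTop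
        (nhds (if F = Finset.univ then
          (1 - (p : ℝ)⁻¹) ^ B * ∑ᶠ β, chainSum r β Finset.univ else 0)) := by
    intro F _
    split_ifs with hF
    · subst hF
      have h : (1 - (p : ℝ)⁻¹) ^ B = ((p : ℝ) - 1) ^ B * (p : ℝ) ^ (-B) := by
        rw [zpow_neg, ← inv_zpow, ← mul_zpow, sub_mul, mul_inv_cancel₀ hp0, one_mul]
      rw [h]
      exact (powerset_recurrence_tendsto hw0 hw1 hwu u0 hu hr).const_mul _
    · simpa using (powerset_recurrence_tendsto_zero hw0 hw1 u0 hu hF).const_mul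
        (((p : ℝ) - 1) ^ b F * (p : ℝ) ^ (-B))
  have h := tendsto_finsetSum _ hlim
  rw [Finset.sum_ite_eq_of_mem' _ _ _
    (Finset.mem_filter.2 ⟨Finset.mem_univ _, hconn_univ⟩)] at h
  exact h
end
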